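/- Let K be an infinite field and n, r ≥ 1. An endomorphism f ∈ End_K(Ẽ^{⊗r}) commutes with every translation operator T_{σ,ε} (i.e. f lies in the centralizer algebra End_{KΣ̂_r}(Ẽ^{⊗r})) if and only if f is a finite K-linear combination of the operators ξ_{i,j}, i, j ∈ I(ℤ,r). Moreover, if R is a set containing exactly one element of each Σ̂_r-orbit of I(ℤ,r) × I(ℤ,r), then the family (ξ_{i,j})_{(i,j)∈R} is K-linearly independent; hence it is a basis of End_{KΣ̂_r}(Ẽ^{⊗r}). (This realizes the affine Schur algebra S̃(n,r) as End_{KΣ̂_r}(Ẽ^{⊗r}).) -/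

import Mathlib

noncomputable section

namespace AffineSchur

variable (K : Type*) [Field K] (n r : ℕ)

/-- The right action of the pair `(σ,ε) ∈ Σ̂_r = Σ_r ⋉ ℤ^r` on `I(ℤ,r)`:
`i·(σ,ε) = i∘σ + n·ε`. -/
def act (σ : Equiv.Perm (Fin r)) (ε : Fin r → ℤ) (i : Fin r → ℤ) : Fin r → ℤ :=
  fun k => i (σ k) + n * ε k

/-- The tensor space `Ẽ^{⊗r}`: the free `K`-module with basis `(v_i)_{i ∈ I(ℤ,r)}`. -/
abbrev TensorSpace := (Fin r → ℤ) →₀ K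

/-- The right-translation operator `T_{σ,ε} : v_i ↦ v_{i·(σ,ε)}`. -/
def transOp (σ : Equiv.Perm (Fin r)) (ε : Fin r → ℤ) :
    Module.End K (TensorSpace K r) :=
  Finsupp.lmapDomain K K (act n r σ ε)

/-- The finite set `{k : (k,l) lies in the Σ̂_r-orbit of (i,j)}`. -/
def xiSupport (i j l : Fin r → ℤ) : Finset (Fin r → ℤ) := by
  classical
  exact (Finset.univ.filter fun σ : Equiv.Perm (Fin r) =>
      ∀ k, (n : ℤ) ∣ (l k - j (σ k))).image
    fun σ => fun k => i (σ k) + (l k - j (σ k))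

/-- The operator `ξ_{i,j} ∈ End_K(Ẽ^{⊗r})` given by
`ξ_{i,j}(v_l) = Σ_{k : (k,l) in the Σ̂_r-orbit of (i,j)} v_k`. -/
def xi (i j : Fin r → ℤ) : Module.End K (TensorSpace K r) :=
  Finsupp.lsum K fun l => LinearMap.toSpanSingleton K _
    (∑ k ∈ xiSupport n r i j l, Finsupp.single k (1 : K))

/-- The centralizer algebra `End_{KΣ̂_r}(Ẽ^{⊗r})` of all the translation operators
`T_{σ,ε}` inside `End_K(Ẽ^{⊗r})` — the affine Schur algebra `S̃(n,r)`. -/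
def affineSchur : Subalgebra K (Module.End K (TensorSpace K r)) :=
  Subalgebra.centralizer K
    (Set.range fun p : Equiv.Perm (Fin r) × (Fin r → ℤ) => transOp K n r p.1 p.2)

end AffineSchur

namespace AffineSchur

/-- The orbit relation. -/
def Rel (n r : ℕ) (p q : (Fin r → ℤ) × (Fin r → ℤ)) : Prop :=
  ∃ (σ : Equiv.Perm (Fin r)) (ε : Fin r → ℤ), q = (act n r σ ε p.1, act n r σ ε p.2)

theorem act_inv (n r : ℕ) (σ : Equiv.Perm (Fin r)) (ε i : Fin r → ℤ) :
    act n r σ⁻¹ (fun k => - ε (σ⁻¹ k)) (act n r σ ε i) = i := by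
  funext k
  simp [act]

theorem act_mul (n r : ℕ) (σ τ : Equiv.Perm (Fin r)) (ε δ i : Fin r → ℤ) :
    act n r τ δ (act n r σ ε i) = act n r (σ * τ) (fun k => ε (τ k) + δ k) i := by
  funext k
  simp [act]
  ring

theorem act_injective (n r : ℕ) (σ : Equiv.Perm (Fin r)) (ε : Fin r → ℤ) :
    Function.Injective (act n r σ ε) :=
  Function.LeftInverse.injective (act_inv n r σ ε)

theorem Rel.refl (n r : ℕ) (p : (Fin r → ℤ) × (Fin r → ℤ)) : Rel n r p p :=
  ⟨1, 0, by ext k <;> simp [act]⟩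

theorem Rel.symm {n r : ℕ} {p q : (Fin r → ℤ) × (Fin r → ℤ)} (h : Rel n r p q) :
    Rel n r q p := by
  obtain ⟨σ, ε, rfl⟩ := h
  exact ⟨σ⁻¹, fun k => - ε (σ⁻¹ k), by simp only [act_inv]⟩

theorem Rel.trans {n r : ℕ} {p q s : (Fin r → ℤ) × (Fin r → ℤ)} (h : Rel n r p q)
    (h' : Rel n r q s) : Rel n r p s := by
  obtain ⟨σ, ε, rfl⟩ := h
  obtain ⟨τ, δ, rfl⟩ := h'
  exact ⟨σ * τ, fun k => ε (τ k) + δ k, by simp only [act_mul]⟩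

theorem mem_xiSupport (n r : ℕ) (i j k l : Fin r → ℤ) :
    k ∈ xiSupport n r i j l ↔ Rel n r (i, j) (k, l) := by
  classical
  simp only [xiSupport, Finset.mem_image, Finset.mem_filter, Finset.mem_univ, true_and, Rel,
    Prod.mk.injEq]
  constructor
  · rintro ⟨σ, h, rfl⟩
    choose ε hε using h
    refine ⟨σ, ε, ?_, ?_⟩
    · funext k
      simp only [act]
      rw [hε]
    · funext k
      simp only [act]
      rw [← hε]
      ring
  · rintro ⟨σ, ε, rfl, rfl⟩
    refine ⟨σ, fun k => ⟨ε k, by simp [act]⟩, ?_⟩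
    funext k
    simp [act]

open Classical in
theorem xi_coeff (K : Type*) [Field K] (n r : ℕ) (i j k l : Fin r → ℤ) :
    (xi K n r i j (Finsupp.single l 1)) k = if Rel n r (i, j) (k, l) then 1 else 0 := by
  simp only [xi, Finsupp.lsum_single, LinearMap.toSpanSingleton_apply, one_smul,
    Finsupp.finsetSum_apply, Finsupp.single_apply, Finset.sum_ite_eq', mem_xiSupport]

theorem end_ext (K : Type*) [Field K] (r : ℕ) (f g : Module.End K (TensorSpace K r))
    (h : ∀ k l, f (Finsupp.single l 1) k = g (Finsupp.single l 1) k) : f = g := by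
  refine Finsupp.lhom_ext' fun l => LinearMap.ext_ring ?_
  ext k
  exact h k l

theorem transOp_single (K : Type*) [Field K] (n r : ℕ) (σ : Equiv.Perm (Fin r))
    (ε l : Fin r → ℤ) :
    transOp K n r σ ε (Finsupp.single l 1) = Finsupp.single (act n r σ ε l) 1 := by
  simp [transOp, Finsupp.lmapDomain_apply, Finsupp.mapDomain_single]

theorem transOp_apply (K : Type*) [Field K] (n r : ℕ) (σ : Equiv.Perm (Fin r))
    (ε k : Fin r → ℤ) (x : TensorSpace K r) :
    transOp K n r σ ε x (act n r σ ε k) = x k := by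
  simp only [transOp, Finsupp.lmapDomain_apply]
  exact Finsupp.mapDomain_apply (act_injective n r σ ε) x k

theorem commutes_iff (K : Type*) [Field K] (n r : ℕ) (f : Module.End K (TensorSpace K r)) :
    (∀ (σ : Equiv.Perm (Fin r)) (ε : Fin r → ℤ),
          f ∘ₗ transOp K n r σ ε = transOp K n r σ ε ∘ₗ f) ↔
    ∀ p q : (Fin r → ℤ) × (Fin r → ℤ), Rel n r p q →
      f (Finsupp.single q.2 1) q.1 = f (Finsupp.single p.2 1) p.1 := by
  constructor
  · rintro h ⟨k, l⟩ _ ⟨σ, ε, rfl⟩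
    have := LinearMap.congr_fun (h σ ε) (Finsupp.single l 1)
    simp only [LinearMap.comp_apply, transOp_single] at this
    simp only [this, transOp_apply]
  · intro h σ ε
    refine end_ext K r _ _ fun k l => ?_
    obtain ⟨k, rfl⟩ : ∃ k', act n r σ ε k' = k := by
      refine ⟨act n r σ⁻¹ (fun k => - ε (σ⁻¹ k)) k, ?_⟩
      funext m
      simp [act]
    simp only [LinearMap.comp_apply, transOp_single, transOp_apply]
    exact h (k, l) _ ⟨σ, ε, rfl⟩

theorem xi_commutes (K : Type*) [Field K] (n r : ℕ) (i j : Fin r → ℤ)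
    (σ : Equiv.Perm (Fin r)) (ε : Fin r → ℤ) :
    xi K n r i j ∘ₗ transOp K n r σ ε = transOp K n r σ ε ∘ₗ xi K n r i j := by
  classical
  revert σ ε
  rw [commutes_iff]
  rintro ⟨k, l⟩ ⟨k', l'⟩ h
  simp only [xi_coeff]
  have : Rel n r (i, j) (k', l') ↔ Rel n r (i, j) (k, l) :=
    ⟨fun h' => h'.trans h.symm, fun h' => h'.trans h⟩
  simp only [this]

theorem span_commutes (K : Type*) [Field K] (n r : ℕ) (f : Module.End K (TensorSpace K r))
    (hf : f ∈ Submodule.span K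
          (Set.range fun p : (Fin r → ℤ) × (Fin r → ℤ) => xi K n r p.1 p.2))
    (σ : Equiv.Perm (Fin r)) (ε : Fin r → ℤ) :
    f ∘ₗ transOp K n r σ ε = transOp K n r σ ε ∘ₗ f := by
  induction hf using Submodule.span_induction with
  | mem x h =>
    obtain ⟨p, rfl⟩ := h
    exact xi_commutes K n r _ _ σ ε
  | zero => simp
  | add x y _ _ hx hy => rw [LinearMap.add_comp, LinearMap.comp_add, hx, hy]
  | smul a x _ hx => rw [LinearMap.smul_comp, LinearMap.comp_smul, hx]

/-- The finite fundamental box. -/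
def box (n r : ℕ) : Finset (Fin r → ℤ) := Fintype.piFinset fun _ => Finset.Ico (0 : ℤ) n

theorem exists_box (n r : ℕ) (hn : 1 ≤ n) (p : (Fin r → ℤ) × (Fin r → ℤ)) :
    ∃ q, Rel n r p q ∧ q.2 ∈ box n r := by
  refine ⟨_, ⟨1, fun k => - (p.2 k / n), rfl⟩, ?_⟩
  have hn' : (0 : ℤ) < n := by exact_mod_cast hn
  simp only [box, Fintype.mem_piFinset, Finset.mem_Ico]
  intro k
  have e : act n r 1 (fun k => - (p.2 k / n)) p.2 k = p.2 k % n := by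
    simp only [act, Equiv.Perm.one_apply, Int.emod_def]
    ring
  rw [e]
  exact ⟨Int.emod_nonneg _ hn'.ne', Int.emod_lt_of_pos _ hn'⟩

theorem mem_span_of_commutes (K : Type*) [Field K] (n r : ℕ) (hn : 1 ≤ n)
    (R : Set ((Fin r → ℤ) × (Fin r → ℤ)))
    (hR : ∀ p, ∃! q, q ∈ R ∧ Rel n r p q)
    (f : Module.End K (TensorSpace K r))
    (hf : ∀ p q : (Fin r → ℤ) × (Fin r → ℤ), Rel n r p q →
      f (Finsupp.single q.2 1) q.1 = f (Finsupp.single p.2 1) p.1) :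
    f ∈ Submodule.span K
            ((fun p : (Fin r → ℤ) × (Fin r → ℤ) => xi K n r p.1 p.2) '' R) := by
  classical
  choose ρ hρ hu using hR
  have hu' : ∀ p q, q ∈ R → Rel n r p q → q = ρ p := fun p q h1 h2 => hu p q ⟨h1, h2⟩
  let P : Finset ((Fin r → ℤ) × (Fin r → ℤ)) :=
    ((box n r).biUnion fun b => (f (Finsupp.single b 1)).support.image fun k => (k, b)).image ρ
  have hPR : ∀ q ∈ P, q ∈ R := by
    intro q hq
    obtain ⟨p, _, rfl⟩ := Finset.mem_image.1 hq
    exact (hρ p).1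
  have key : f = ∑ q ∈ P, f (Finsupp.single q.2 1) q.1 • xi K n r q.1 q.2 := by
    refine end_ext K r _ _ fun k l => ?_
    rw [LinearMap.sum_apply, Finsupp.finsetSum_apply]
    simp only [LinearMap.smul_apply, Finsupp.smul_apply, xi_coeff, smul_eq_mul]
    have h0 := (hρ (k, l)).2
    have hc := hf _ _ h0
    rw [Finset.sum_eq_single (ρ (k, l))]
    · rw [if_pos h0.symm, mul_one, hc]
    · intro q hq hne
      rw [if_neg, mul_zero]
      exact fun h => hne (hu' _ _ (hPR q hq) h.symm)
    · intro hnot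
      have : f (Finsupp.single (ρ (k, l)).2 1) (ρ (k, l)).1 = 0 := by
        by_contra hne
        apply hnot
        obtain ⟨s, hs, hb⟩ := exists_box n r hn (k, l)
        refine Finset.mem_image.2 ⟨s, ?_, (hu' _ _ (hρ s).1 (hs.trans (hρ s).2))⟩
        refine Finset.mem_biUnion.2 ⟨s.2, hb, Finset.mem_image.2 ⟨s.1, ?_, rfl⟩⟩
        rw [Finsupp.mem_support_iff, hf _ _ hs, ← hc]
        exact hne
      rw [this, zero_mul]
  rw [key]
  exact Submodule.sum_mem _ fun q hq =>
    Submodule.smul_mem _ _ (Submodule.subset_span ⟨q, hPR q hq, rfl⟩)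

theorem exists_reps (n r : ℕ) : ∃ R : Set ((Fin r → ℤ) × (Fin r → ℤ)),
    ∀ p, ∃! q, q ∈ R ∧ Rel n r p q := by
  let S : Setoid ((Fin r → ℤ) × (Fin r → ℤ)) :=
    ⟨Rel n r, Rel.refl n r, Rel.symm, Rel.trans⟩
  refine ⟨Set.range (Quotient.out (s := S)), fun p => ⟨(Quotient.mk S p).out,
    ⟨⟨_, rfl⟩, Rel.symm (Quotient.mk_out (s := S) p)⟩, ?_⟩⟩
  rintro _ ⟨⟨x, rfl⟩, h⟩
  have : Quotient.mk S p = Quotient.mk S x.out := Quotient.sound h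
  rw [this, Quotient.out_eq]

/-- an endomorphism of Ẽ^{⊗r} commutes with every translation operator
T_{σ,ε} (i.e. lies in the centralizer algebra End_{KΣ̂_r}(Ẽ^{⊗r})) iff it is a finite
K-linear combination of the operators ξ_{i,j}; moreover, for any set R of representatives
of the Σ̂_r-orbits of I(ℤ,r)×I(ℤ,r), the family (ξ_{i,j})_{(i,j)∈R} is K-linearly
independent, hence a basis of End_{KΣ̂_r}(Ẽ^{⊗r}) = S̃(n,r). -/
theorem centralizer_eq_span_xi (K : Type*) [Field K] [Infinite K]
    (n r : ℕ) (hn : 1 ≤ n) (hr : 1 ≤ r) :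
    (∀ f : Module.End K (TensorSpace K r),
      (∀ (σ : Equiv.Perm (Fin r)) (ε : Fin r → ℤ),
          f ∘ₗ transOp K n r σ ε = transOp K n r σ ε ∘ₗ f) ↔
        f ∈ Submodule.span K
          (Set.range fun p : (Fin r → ℤ) × (Fin r → ℤ) => xi K n r p.1 p.2)) ∧
    ∀ R : Set ((Fin r → ℤ) × (Fin r → ℤ)),
      (∀ p : (Fin r → ℤ) × (Fin r → ℤ),
        ∃! q, q ∈ R ∧ ∃ (σ : Equiv.Perm (Fin r)) (ε : Fin r → ℤ),
          q = (act n r σ ε p.1, act n r σ ε p.2)) →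
      LinearIndependent K (fun q : R => xi K n r q.1.1 q.1.2) ∧
      ∀ f : Module.End K (TensorSpace K r),
        f ∈ Submodule.span K
            ((fun p : (Fin r → ℤ) × (Fin r → ℤ) => xi K n r p.1 p.2) '' R) ↔
        (∀ (σ : Equiv.Perm (Fin r)) (ε : Fin r → ℤ),
          f ∘ₗ transOp K n r σ ε = transOp K n r σ ε ∘ₗ f) := by
  classical
  refine ⟨fun f => ⟨fun h => ?_, fun h => span_commutes K n r f h⟩, fun R hR => ⟨?_, fun f =>
    ⟨fun h => ?_, fun h => ?_⟩⟩⟩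
  · obtain ⟨R, hR⟩ := exists_reps n r
    exact Submodule.span_mono (Set.image_subset_range _ _)
      (mem_span_of_commutes K n r hn R hR f ((commutes_iff K n r f).1 h))
  · have key : ∀ (g : R →₀ K) (q : R),
        (Finsupp.linearCombination K (fun q : R => xi K n r q.1.1 q.1.2) g)
          (Finsupp.single q.1.2 1) q.1.1 = g q := by
      intro g q
      rw [Finsupp.linearCombination_apply, Finsupp.sum, LinearMap.sum_apply,
        Finsupp.finsetSum_apply]
      simp only [LinearMap.smul_apply, Finsupp.smul_apply, xi_coeff, smul_eq_mul]
      rw [Finset.sum_eq_single q]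
      · rw [if_pos (Rel.refl n r _), mul_one]
      · intro q' _ hne
        rw [if_neg, mul_zero]
        intro h
        exact hne (Subtype.ext ((hR q'.1).unique ⟨q'.2, Rel.refl n r _⟩ ⟨q.2, h⟩))
      · intro h
        rw [Finsupp.notMem_support_iff.1 h, zero_mul]
    intro g g' h
    ext q
    rw [← key g q, ← key g' q, h]
  · exact span_commutes K n r f (Submodule.span_mono (Set.image_subset_range _ _) h)
  · exact mem_span_of_commutes K n r hn R hR f ((commutes_iff K n r f).1 h)

end AffineSchur
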